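/- arXiv:1911.01541 — 2 statements merged into one kernel-verified Lean document; each statement's English description precedes it below -/
import Mathlib

section
/- Let S be a nonnegative real m×n matrix with no zero row and no zero column, and let D₁ (m×m) and D₂ (n×n) be diagonal matrices with strictly positive diagonal entries such that D₁S is row-normalized (the maximum entry of every row of D₁S equals 1) and S' := D₁ S D₂ is column-normalized (the maximum entry of every column of S' equals 1). Then hsb(S') ≥ hsb(S). -/
open scoped Classical
open Matrix BigOperators

/-- The Frobenius inner product of two real matrices. -/
def frob {m n : Type*} [Fintype m] [Fintype n] (A B : Matrix m n ℝ) : ℝ :=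
  ∑ i, ∑ j, A i j * B i j

/-- The maximum absolute value of an entry of a real matrix. -/
noncomputable def mnorm {m n : Type*} [Fintype m] [Fintype n] (S : Matrix m n ℝ) : ℝ :=
  ⨆ p : m × n, |S p.1 p.2|

/-- The finite set `R_{m,n}` of rank-one 0/1 matrices. -/
noncomputable def rankOne01 (m n : Type*) [Fintype m] [Fintype n] :
    Finset (Matrix m n ℝ) :=
  ((Finset.univ : Finset (Matrix m n Bool)).image
      (fun B => Matrix.of fun i j => if B i j then (1 : ℝ) else 0)).filter
    (fun R => R.rank = 1)

/-- The hyperplane separation bound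
`hsb S = ‖S‖⁻¹ ⬝ sup { ⟨S,X⟩ : ⟨X,R⟩ ≤ 1 for all rank-one 0/1 matrices R }`. -/
noncomputable def hsb {m n : Type*} [Fintype m] [Fintype n] (S : Matrix m n ℝ) : ℝ :=
  (mnorm S)⁻¹ *
    sSup {t : ℝ | ∃ X : Matrix m n ℝ,
      (∀ R ∈ rankOne01 m n, frob X R ≤ 1) ∧ t = frob S X}

/-- A rank-one matrix has the form `i j ↦ p i * q j`. -/
theorem exists_eq_mul_of_rank_eq_one {m n : Type*} [Fintype m] [Fintype n]
    (R : Matrix m n ℝ) (h : R.rank = 1) :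
    ∃ (p : m → ℝ) (q : n → ℝ), ∀ i j, R i j = p i * q j := by
  rw [Matrix.rank_eq_finrank_span_cols, finrank_eq_one_iff'] at h
  obtain ⟨v, -, hv⟩ := h
  have hcol (j : n) : ∃ c : ℝ, ∀ i, R i j = (v : m → ℝ) i * c := by
    obtain ⟨c, hc⟩ := hv ⟨R.col j, Submodule.subset_span ⟨j, rfl⟩⟩
    refine ⟨c, fun i => ?_⟩
    have := congrFun (congrArg Subtype.val hc) i
    simp only [Submodule.coe_smul, Pi.smul_apply, smul_eq_mul, Matrix.col_apply] at this
    rw [← this, mul_comm]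
  choose q hq using hcol
  exact ⟨v, q, fun i j => hq j i⟩

/-- A rank-one 0/1 matrix is the indicator of a combinatorial rectangle. -/
theorem exists_rectangle_of_mem_rankOne01 {m n : Type*} [Fintype m] [Fintype n]
    {R : Matrix m n ℝ} (h : R ∈ rankOne01 m n) :
    ∃ (I : Finset m) (J : Finset n), ∀ i j, R i j = if i ∈ I ∧ j ∈ J then 1 else 0 := by
  obtain ⟨hB, hrank⟩ := Finset.mem_filter.1 h
  obtain ⟨B, -, hB⟩ := Finset.mem_image.1 hB
  obtain ⟨p, q, hpq⟩ := exists_eq_mul_of_rank_eq_one R hrank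
  refine ⟨Finset.univ.filter (p · ≠ 0), Finset.univ.filter (q · ≠ 0), fun i j => ?_⟩
  have h01 : R i j = 0 ∨ R i j = 1 := by
    rw [← hB, Matrix.of_apply]
    split_ifs <;> simp
  have hij := hpq i j
  by_cases hp : p i = 0
  · simp [hij, hp]
  by_cases hq : q j = 0
  · simp [hij, hq]
  have h0 : R i j ≠ 0 := hij ▸ mul_ne_zero hp hq
  simp [hp, hq, h01.resolve_left h0]

/-- The indicator of a nonempty combinatorial rectangle is a rank-one 0/1 matrix. -/
theorem rectangle_mem_rankOne01 {m n : Type*} [Fintype m] [Fintype n]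
    {I : Finset m} {J : Finset n} (hI : I.Nonempty) (hJ : J.Nonempty) :
    (Matrix.of fun i j => if i ∈ I ∧ j ∈ J then (1 : ℝ) else 0) ∈ rankOne01 m n := by
  refine Finset.mem_filter.2 ⟨Finset.mem_image.2
    ⟨fun i j => decide (i ∈ I ∧ j ∈ J), Finset.mem_univ _, by ext; simp⟩, ?_⟩
  set R : Matrix m n ℝ := Matrix.of fun i j => if i ∈ I ∧ j ∈ J then (1 : ℝ) else 0 with hR
  refine le_antisymm ?_ (Nat.one_le_iff_ne_zero.2 fun h0 => ?_)
  · have : R = Matrix.vecMulVec (fun i => if i ∈ I then (1 : ℝ) else 0)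
        (fun j => if j ∈ J then (1 : ℝ) else 0) := by
      ext i j
      by_cases hi : i ∈ I <;> simp [hR, Matrix.vecMulVec_apply, hi]
    rw [this]
    exact Matrix.rank_vecMulVec_le _ _
  · obtain ⟨i, hi⟩ := hI
    obtain ⟨j, hj⟩ := hJ
    rw [Matrix.rank_eq_finrank_span_cols, Submodule.finrank_eq_zero, Submodule.span_eq_bot] at h0
    have := congrFun (h0 (R.col j) ⟨j, rfl⟩) i
    simp [hR, hi, hj] at this

/-- A matrix satisfying the rank-one constraints has entry sum at most one on every
combinatorial rectangle. -/
theorem sum_rectangle_le_one {m n : Type*} [Fintype m] [Fintype n] {X : Matrix m n ℝ}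
    (hX : ∀ R ∈ rankOne01 m n, frob X R ≤ 1) (I : Finset m) (J : Finset n) :
    ∑ i ∈ I, ∑ j ∈ J, X i j ≤ 1 := by
  rcases I.eq_empty_or_nonempty with rfl | hI
  · simp
  rcases J.eq_empty_or_nonempty with rfl | hJ
  · simp
  have h := hX _ (rectangle_mem_rankOne01 hI hJ)
  simpa [frob, ite_and, Finset.sum_ite_mem] using h

/-- A linear form on the cube `[0,1]^ι` is dominated by its value at a vertex. -/
theorem sum_mul_le_sum_filter_pos {ι : Type*} [Fintype ι] (a c : ι → ℝ)
    (h0 : ∀ i, 0 ≤ a i) (h1 : ∀ i, a i ≤ 1) :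
    ∑ i, a i * c i ≤ ∑ i ∈ Finset.univ.filter (0 < c ·), c i := by
  rw [Finset.sum_filter]
  refine Finset.sum_le_sum fun i _ => ?_
  split_ifs with h
  · exact mul_le_of_le_one_left h.le (h1 i)
  · exact mul_nonpos_of_nonneg_of_nonpos (h0 i) (not_lt.1 h)

/-- A matrix satisfying the rank-one constraints has bilinear form at most one on the cubes. -/
theorem sum_mul_mul_le_one {m n : Type*} [Fintype m] [Fintype n] {X : Matrix m n ℝ}
    (hX : ∀ R ∈ rankOne01 m n, frob X R ≤ 1) (a : m → ℝ) (b : n → ℝ)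
    (ha0 : ∀ i, 0 ≤ a i) (ha1 : ∀ i, a i ≤ 1) (hb0 : ∀ j, 0 ≤ b j) (hb1 : ∀ j, b j ≤ 1) :
    ∑ i, a i * ∑ j, b j * X i j ≤ 1 := by
  refine (sum_mul_le_sum_filter_pos a _ ha0 ha1).trans ?_
  rw [Finset.sum_comm]
  simp only [← Finset.mul_sum]
  refine (sum_mul_le_sum_filter_pos b _ hb0 hb1).trans ?_
  rw [Finset.sum_comm]
  exact sum_rectangle_le_one hX _ _

/-- Scaling rows and columns by factors in `[0,1]` preserves the rank-one constraints. -/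
theorem frob_scale_le_one {m n : Type*} [Fintype m] [Fintype n] {X : Matrix m n ℝ}
    (hX : ∀ R ∈ rankOne01 m n, frob X R ≤ 1) (a : m → ℝ) (b : n → ℝ)
    (ha0 : ∀ i, 0 ≤ a i) (ha1 : ∀ i, a i ≤ 1) (hb0 : ∀ j, 0 ≤ b j) (hb1 : ∀ j, b j ≤ 1) :
    ∀ R ∈ rankOne01 m n, frob (Matrix.of fun i j => a i * b j * X i j) R ≤ 1 := by
  intro R hR
  obtain ⟨I, J, hIJ⟩ := exists_rectangle_of_mem_rankOne01 hR
  convert sum_mul_mul_le_one hX (fun i => if i ∈ I then a i else 0)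
    (fun j => if j ∈ J then b j else 0) ?_ ?_ ?_ ?_ using 1
  · simp only [frob, Finset.mul_sum]
    refine Finset.sum_congr rfl fun i _ => Finset.sum_congr rfl fun j _ => ?_
    rw [hIJ]
    by_cases hi : i ∈ I <;> by_cases hj : j ∈ J <;> simp [hi, hj, mul_assoc]
  all_goals
    intro k
    split_ifs <;> simp [ha0, ha1, hb0, hb1]

/-- The objective values of the hyperplane separation bound of a nonnegative matrix are bounded. -/
theorem bddAbove_frob {m n : Type*} [Fintype m] [Fintype n] {S : Matrix m n ℝ}
    (hS : ∀ i j, 0 ≤ S i j) :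
    BddAbove {t : ℝ | ∃ X : Matrix m n ℝ,
      (∀ R ∈ rankOne01 m n, frob X R ≤ 1) ∧ t = frob S X} := by
  refine ⟨∑ i, ∑ j, S i j, ?_⟩
  rintro t ⟨X, hX, rfl⟩
  refine Finset.sum_le_sum fun i _ => Finset.sum_le_sum fun j _ => ?_
  have h := sum_rectangle_le_one hX {i} {j}
  simp only [Finset.sum_singleton] at h
  exact mul_le_of_le_one_right (hS i j) h

/-- Every entry of a matrix is at most its maximum norm. -/
theorem le_mnorm {m n : Type*} [Fintype m] [Fintype n] (S : Matrix m n ℝ) (i : m) (j : n) :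
    S i j ≤ mnorm S :=
  (le_abs_self _).trans
    (le_ciSup (f := fun p : m × n => |S p.1 p.2|) (Set.finite_range _).bddAbove (i, j))

/-- A nonnegative column-normalized matrix with at least one entry has maximum norm one. -/
theorem mnorm_eq_one {m n : Type*} [Fintype m] [Fintype n] [Nonempty m] [Nonempty n]
    {S : Matrix m n ℝ} (hS : ∀ i j, 0 ≤ S i j) (hcol : ∀ j, (⨆ i, S i j) = 1) :
    mnorm S = 1 := by
  refine le_antisymm (ciSup_le fun p => ?_) ?_
  · rw [abs_of_nonneg (hS _ _), ← hcol p.2]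
    exact le_ciSup (f := fun i => S i p.2) (Set.finite_range _).bddAbove p.1
  · obtain ⟨j⟩ := ‹Nonempty n›
    rw [← hcol j]
    exact ciSup_le fun i => le_mnorm S i j

/-- If a positive diagonal scaling `S' = D₁ S D₂` of a nonnegative matrix `S` without zero
rows and without zero columns is such that `D₁ S` is row-normalized and `S'` is
column-normalized, then `hsb S' ≥ hsb S`. -/
theorem hsb_le_hsb_normalized {m n : ℕ}
    (S : Matrix (Fin m) (Fin n) ℝ) (hS : ∀ i j, 0 ≤ S i j)
    (hrow : ∀ i, ∃ j, S i j ≠ 0) (hcol : ∀ j, ∃ i, S i j ≠ 0)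
    (d₁ : Fin m → ℝ) (d₂ : Fin n → ℝ) (hd₁ : ∀ i, 0 < d₁ i) (hd₂ : ∀ j, 0 < d₂ j)
    (hrownorm : ∀ i, (⨆ j, (Matrix.diagonal d₁ * S) i j) = 1)
    (hcolnorm : ∀ j, (⨆ i, (Matrix.diagonal d₁ * S * Matrix.diagonal d₂) i j) = 1) :
    hsb S ≤ hsb (Matrix.diagonal d₁ * S * Matrix.diagonal d₂) := by
  rcases isEmpty_or_nonempty (Fin m) with hm | hm
  · exact le_of_eq (congrArg hsb (Subsingleton.elim _ _))
  rcases isEmpty_or_nonempty (Fin n) with hn | hn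
  · exact le_of_eq (congrArg hsb (Subsingleton.elim _ _))
  set S' := Matrix.diagonal d₁ * S * Matrix.diagonal d₂ with hS'_def
  have hS'_apply (i j) : S' i j = d₁ i * S i j * d₂ j := by
    simp [hS'_def, Matrix.mul_diagonal, Matrix.diagonal_mul]
  have hS' (i j) : 0 ≤ S' i j := by
    rw [hS'_apply]
    exact mul_nonneg (mul_nonneg (hd₁ i).le (hS i j)) (hd₂ j).le
  have hpos : 0 < mnorm S := by
    obtain ⟨i⟩ := hm
    obtain ⟨j, hj⟩ := hrow i
    exact ((hS i j).lt_of_ne' hj).trans_le (le_mnorm S i j)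
  have hd₁_inv (i) : (d₁ i)⁻¹ ≤ mnorm S := by
    obtain ⟨j, hj⟩ := exists_eq_ciSup_of_finite (f := fun j => (Matrix.diagonal d₁ * S) i j)
    rw [hrownorm, Matrix.diagonal_mul] at hj
    rw [← eq_inv_of_mul_eq_one_right hj]
    exact le_mnorm S i j
  have hd₂_inv (j) : (d₂ j)⁻¹ ≤ 1 := by
    obtain ⟨i, hi⟩ := exists_eq_ciSup_of_finite (f := fun i => S' i j)
    rw [hcolnorm, hS'_def, Matrix.mul_diagonal] at hi
    rw [← eq_inv_of_mul_eq_one_left hi, ← hrownorm i]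
    exact le_ciSup (f := fun j => (Matrix.diagonal d₁ * S) i j) (Set.finite_range _).bddAbove j
  rw [hsb, hsb, mnorm_eq_one hS' hcolnorm, inv_one, one_mul, inv_mul_le_iff₀ hpos]
  refine csSup_le ⟨_, 0, fun R _ => by simp [frob], rfl⟩ ?_
  rintro t ⟨X, hX, rfl⟩
  rw [← inv_mul_le_iff₀ hpos]
  refine le_csSup (bddAbove_frob hS')
    ⟨_, frob_scale_le_one hX (fun i => (mnorm S)⁻¹ * (d₁ i)⁻¹) (fun j => (d₂ j)⁻¹)
      (fun i => mul_nonneg (inv_nonneg.2 hpos.le) (inv_nonneg.2 (hd₁ i).le))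
      (fun i => by rw [inv_mul_le_iff₀ hpos, mul_one]; exact hd₁_inv i)
      (fun j => inv_nonneg.2 (hd₂ j).le) hd₂_inv, ?_⟩
  simp only [frob, Finset.mul_sum]
  refine Finset.sum_congr rfl fun i _ => Finset.sum_congr rfl fun j _ => ?_
  have h₁ := (hd₁ i).ne'
  have h₂ := (hd₂ j).ne'
  rw [hS'_apply, Matrix.of_apply]
  field_simp
end

section
/- Let A = (a_{ij}) be a symmetric nonnegative n×n real matrix with a_{ij} > 0 for at least one pair i ≠ j. Let M_A be the matrix whose rows are indexed by the nonempty proper subsets S of [n] and whose columns are indexed by the permutations π of [n], with entry M_A[S,π] = Σ_{i ∉ S, j ∈ S, π(i) ≤ π(j)} a_{ij}. Then hsb(M_A) ≤ 4. -/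
open scoped Classical
open Matrix BigOperators

/-- The slack matrix `M_A` of the graphic zonotope `Z(A)`: rows are indexed by the
nonempty proper subsets `S` of `[n]`, columns by the permutations `π` of `[n]`, and the
entry in position `(S, π)` is `∑_{i ∉ S, j ∈ S, π(i) ≤ π(j)} a_{ij}`. -/
noncomputable def zonotopeSlack {n : ℕ} (A : Matrix (Fin n) (Fin n) ℝ) :
    Matrix {S : Finset (Fin n) // S.Nonempty ∧ S ≠ Finset.univ} (Equiv.Perm (Fin n)) ℝ :=
  Matrix.of fun S π =>
    ∑ i ∈ (S : Finset (Fin n))ᶜ, ∑ j ∈ (S : Finset (Fin n)),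
      if π i ≤ π j then A i j else 0


theorem eq_zero_of_rank_eq_zero {m n : Type*} [Fintype m] [Fintype n] {R : Matrix m n ℝ}
    (h : R.rank = 0) : R = 0 := by
  rw [Matrix.rank, Submodule.finrank_eq_zero, LinearMap.range_eq_bot] at h
  refine ext_of_mulVec_single fun j => ?_
  rw [zero_mulVec]
  exact LinearMap.congr_fun h (Pi.single j 1)

theorem frob_vecMulVec_le_one {m n : Type*} [Fintype m] [Fintype n] {X : Matrix m n ℝ}
    (hX : ∀ R ∈ rankOne01 m n, frob X R ≤ 1) (p : m → Prop) (q : n → Prop) :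
    frob X (vecMulVec (fun i => if p i then 1 else 0) (fun j => if q j then 1 else 0)) ≤ 1 := by
  set R : Matrix m n ℝ :=
    vecMulVec (fun i => if p i then 1 else 0) (fun j => if q j then 1 else 0) with hR
  by_cases h0 : R = 0
  · simp [h0, frob]
  · refine hX R (Finset.mem_filter.2 ⟨Finset.mem_image.2
      ⟨Matrix.of fun i j => decide (p i ∧ q j), Finset.mem_univ _, ?_⟩, ?_⟩)
    · ext i j
      by_cases hp : p i <;> by_cases hq : q j <;> simp [hR, vecMulVec_apply, hp, hq]
    · exact le_antisymm (rank_vecMulVec_le _ _)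
        (Nat.one_le_iff_ne_zero.2 fun h => h0 (eq_zero_of_rank_eq_zero h))

/-- If `S` is a nonnegative combination of rank-one 0/1 matrices, then `⟨S, X⟩` is at most the
total weight for every `X` feasible for the hyperplane separation bound. -/
theorem frob_le_sum_of_rectangles {m n ι : Type*} [Fintype m] [Fintype n]
    {X : Matrix m n ℝ} (hX : ∀ R ∈ rankOne01 m n, frob X R ≤ 1) (s : Finset ι) (w : ι → ℝ)
    (hw : ∀ k ∈ s, 0 ≤ w k) (p : ι → m → Prop) (q : ι → n → Prop) {S : Matrix m n ℝ}
    (hS : ∀ i j, S i j = ∑ k ∈ s, w k * ((if p k i then 1 else 0) * (if q k j then 1 else 0))) :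
    frob S X ≤ ∑ k ∈ s, w k := by
  have h : frob S X = ∑ k ∈ s, w k * frob X
      (vecMulVec (fun i => if p k i then 1 else 0) (fun j => if q k j then 1 else 0)) := by
    simp only [frob, hS, vecMulVec_apply, Finset.mul_sum, Finset.sum_mul]
    conv_rhs => rw [Finset.sum_comm]
    refine Finset.sum_congr rfl fun i _ => ?_
    conv_rhs => rw [Finset.sum_comm]
    exact Finset.sum_congr rfl fun j _ => Finset.sum_congr rfl fun k _ => by ring
  rw [h]
  exact Finset.sum_le_sum fun k hk =>
    mul_le_of_le_one_right (hw k hk) (frob_vecMulVec_le_one hX _ _)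

/-- The total weight of the off-diagonal entries of `A`. -/
def offDiagSum {n : ℕ} (A : Matrix (Fin n) (Fin n) ℝ) : ℝ :=
  ∑ k ∈ (Finset.univ : Finset (Fin n)).offDiag, A k.1 k.2

/-- The total weight of `A` from the complement of `S` to `S`. -/
noncomputable def cutWeight {n : ℕ} (A : Matrix (Fin n) (Fin n) ℝ) (S : Finset (Fin n)) : ℝ :=
  ∑ i ∈ Sᶜ, ∑ j ∈ S, A i j

theorem sum_compl_sum_eq_sum_offDiag {n : ℕ} (S : Finset (Fin n)) (f : Fin n → Fin n → ℝ) :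
    ∑ i ∈ Sᶜ, ∑ j ∈ S, f i j = ∑ k ∈ (Finset.univ : Finset (Fin n)).offDiag,
      if k.1 ∉ S ∧ k.2 ∈ S then f k.1 k.2 else 0 := by
  rw [← Finset.sum_product', ← Finset.sum_filter]
  refine Finset.sum_congr ?_ fun _ _ => rfl
  ext ⟨i, j⟩
  simp only [Finset.mem_product, Finset.mem_compl, Finset.mem_filter, Finset.mem_offDiag,
    Finset.mem_univ, true_and]
  exact ⟨fun h => ⟨fun e => h.1 (e ▸ h.2), h⟩, fun h => h.2⟩

theorem four_mul_card_separating {n : ℕ} {i j : Fin n} (hij : i ≠ j) :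
    4 * (Finset.univ.filter fun S : Finset (Fin n) => i ∉ S ∧ j ∈ S).card = 2 ^ n := by
  have h : (Finset.univ.filter fun S : Finset (Fin n) => i ∉ S ∧ j ∈ S)
      = Finset.Icc {j} {i}ᶜ := by
    ext S
    simp [Finset.subset_compl_comm (s := S), Finset.singleton_subset_iff, and_comm]
  have hn : 2 ≤ n := by
    have := Finset.card_le_univ ({i, j} : Finset (Fin n))
    rwa [Finset.card_pair hij, Fintype.card_fin] at this
  rw [h, Finset.card_Icc_finset (by simpa using hij), Finset.card_compl,
    Finset.card_singleton, Finset.card_singleton, Fintype.card_fin]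
  obtain ⟨m, rfl⟩ := Nat.exists_eq_add_of_le' hn
  simp [pow_succ]
  ring

theorem exists_offDiagSum_le_four_mul_cutWeight {n : ℕ} (A : Matrix (Fin n) (Fin n) ℝ) :
    ∃ S, offDiagSum A ≤ 4 * cutWeight A S := by
  have hsum : ∑ S, 4 * cutWeight A S = ∑ _S : Finset (Fin n), offDiagSum A := by
    have hcut : ∀ S, cutWeight A S = ∑ k ∈ (Finset.univ : Finset (Fin n)).offDiag,
        if k.1 ∉ S ∧ k.2 ∈ S then A k.1 k.2 else 0 :=
      fun S => sum_compl_sum_eq_sum_offDiag S fun i j => A i j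
    simp only [hcut]
    rw [← Finset.mul_sum, Finset.sum_comm, Finset.sum_const, offDiagSum, Finset.smul_sum,
      Finset.mul_sum]
    refine Finset.sum_congr rfl fun k hk => ?_
    rw [← Finset.sum_filter, Finset.sum_const, nsmul_eq_mul, nsmul_eq_mul, ← mul_assoc,
      Finset.card_univ, Fintype.card_finset, Fintype.card_fin,
      ← four_mul_card_separating (Finset.mem_offDiag.1 hk).2.2]
    push_cast
    rfl
  obtain ⟨S, -, hS⟩ := Finset.exists_le_of_sum_le Finset.univ_nonempty hsum.ge
  exact ⟨S, hS⟩

theorem exists_perm_compl_le {n : ℕ} (S : Finset (Fin n)) :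
    ∃ π : Equiv.Perm (Fin n), ∀ i ∉ S, ∀ j ∈ S, π i ≤ π j := by
  let f : Fin n → ℕ := fun i => if i ∈ S then 1 else 0
  refine ⟨(Tuple.sort f)⁻¹, fun i hi j hj => le_of_not_gt fun hlt => ?_⟩
  have := Tuple.monotone_sort f hlt.le
  simp [f, hi, hj] at this

theorem abs_apply_le_mnorm {m n : Type*} [Fintype m] [Fintype n] (S : Matrix m n ℝ)
    (i : m) (j : n) : |S i j| ≤ mnorm S :=
  le_ciSup (f := fun p : m × n => |S p.1 p.2|) (Set.finite_range _).bddAbove (i, j)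

theorem cutWeight_le_mnorm_zonotopeSlack {n : ℕ} (A : Matrix (Fin n) (Fin n) ℝ)
    {S : Finset (Fin n)} (hS : S.Nonempty ∧ S ≠ Finset.univ) :
    cutWeight A S ≤ mnorm (zonotopeSlack A) := by
  obtain ⟨π, hπ⟩ := exists_perm_compl_le S
  have h : zonotopeSlack A ⟨S, hS⟩ π = cutWeight A S :=
    Finset.sum_congr rfl fun i hi => Finset.sum_congr rfl fun j hj =>
      if_pos (hπ i (Finset.mem_compl.1 hi) j hj)
  exact h ▸ (le_abs_self _).trans (abs_apply_le_mnorm _ _ _)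

theorem frob_zonotopeSlack_le {n : ℕ} {A : Matrix (Fin n) (Fin n) ℝ} (hnn : ∀ i j, 0 ≤ A i j)
    {X : Matrix {S : Finset (Fin n) // S.Nonempty ∧ S ≠ Finset.univ} (Equiv.Perm (Fin n)) ℝ}
    (hX : ∀ R ∈ rankOne01 _ _, frob X R ≤ 1) :
    frob (zonotopeSlack A) X ≤ offDiagSum A := by
  refine frob_le_sum_of_rectangles hX _ (fun k : Fin n × Fin n => A k.1 k.2)
    (fun k _ => hnn _ _) (fun k S => k.1 ∉ S.1 ∧ k.2 ∈ S.1) (fun k π => π k.1 ≤ π k.2)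
    fun S π => ?_
  rw [zonotopeSlack, of_apply, sum_compl_sum_eq_sum_offDiag]
  refine Finset.sum_congr rfl fun k _ => ?_
  split_ifs <;> simp

/-- For every symmetric nonnegative matrix `A` with a positive off-diagonal entry, the
hyperplane separation bound of the slack matrix `M_A` of the graphic zonotope `Z(A)` is
at most `4`. -/
theorem hsb_zonotopeSlack_le_four {n : ℕ} (A : Matrix (Fin n) (Fin n) ℝ)
    (hsymm : A.IsSymm) (hnn : ∀ i j, 0 ≤ A i j)
    (hpos : ∃ i j : Fin n, i ≠ j ∧ 0 < A i j) :
    hsb (zonotopeSlack A) ≤ 4 := by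
  have hW : 0 < offDiagSum A := by
    obtain ⟨i, j, hij, h⟩ := hpos
    exact Finset.sum_pos' (fun k _ => hnn _ _) ⟨(i, j), by simpa using hij, h⟩
  obtain ⟨S, hcut⟩ := exists_offDiagSum_le_four_mul_cutWeight A
  have hS : S.Nonempty ∧ S ≠ Finset.univ := by
    refine ⟨Finset.nonempty_iff_ne_empty.2 ?_, ?_⟩ <;> rintro rfl <;>
      simp only [cutWeight, Finset.compl_univ, Finset.sum_empty, Finset.sum_const_zero] at hcut <;>
      linarith
  have hle := cutWeight_le_mnorm_zonotopeSlack A hS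
  rw [hsb, inv_mul_le_iff₀ (by linarith)]
  refine (Real.sSup_le ?_ hW.le).trans (by linarith)
  rintro _ ⟨X, hX, rfl⟩
  exact frob_zonotopeSlack_le hnn hX
end
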